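/- Every automorphism-invariant module satisfies the finite exchange property. -/

import Mathlib

/-- A submodule is essential if it intersects every nonzero submodule nontrivially. -/
def IsEssential {R M : Type*} [Ring R] [AddCommGroup M] [Module R M]
    (N : Submodule R M) : Prop :=
  ∀ K : Submodule R M, K ≠ ⊥ → N ⊓ K ≠ ⊥

/-- The finite exchange property for a module M. -/
def FiniteExchange (R : Type u) [Ring R] (M : Type v) [AddCommGroup M]
    [Module R M] : Prop :=
  ∀ (A : Type v) [AddCommGroup A] [Module R A] (n : ℕ)
    (Mp N : Submodule R A) (Ai : Fin n → Submodule R A),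
    IsCompl Mp N → Nonempty (↥Mp ≃ₗ[R] M) →
    iSupIndep Ai → iSup Ai = ⊤ →
    ∃ B : Fin n → Submodule R A, (∀ i, B i ≤ Ai i) ∧
      iSupIndep (Fin.cons Mp B : Fin (n + 1) → Submodule R A) ∧
      iSup (Fin.cons Mp B : Fin (n + 1) → Submodule R A) = ⊤

section RingTheory

variable {S : Type*} [Ring S]

theorem mem_of_sq_eq_zero (U : Subring S) (hU : ∀ s : S, IsUnit s → s ∈ U) {n : S}
    (hn : n * n = 0) : n ∈ U := by
  have h : IsUnit (1 + n) := by
    refine ⟨⟨1 + n, 1 - n, ?_, ?_⟩, rfl⟩ <;> noncomm_ring <;> simp [hn]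
  simpa using U.sub_mem (hU _ h) U.one_mem

/-- If `α` and `β` are mutually inverse between the orthogonal idempotents `p` and `q`, then a
subring containing all units contains the two-sided ideal generated by `p`. -/
theorem mul_mul_mem_of_equivalent (U : Subring S) (hU : ∀ s : S, IsUnit s → s ∈ U)
    {p q α β : S} (hp : p * p = p) (hpq : p * q = 0) (hqp : q * p = 0)
    (hβα : β * α = p) (hqα : q * α = α) (hαp : α * p = α) (hβq : β * q = β)
    (s t : S) : s * p * t ∈ U := by
  have hα : α ∈ U := mem_of_sq_eq_zero U hU (by
    rw [← hqα, ← hαp]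
    simp only [mul_assoc]
    rw [← mul_assoc p q, hpq]; simp)
  have hβp : β * p = 0 := by rw [← hβq, mul_assoc, hqp, mul_zero]
  have hcorner (x : S) : p * x * p ∈ U := by
    have h : p * x * β ∈ U := mem_of_sq_eq_zero U hU (by
      rw [show p * x * β * (p * x * β) = p * x * (β * p) * x * β by noncomm_ring, hβp]; simp)
    have := U.mul_mem h hα
    rwa [mul_assoc, hβα] at this
  have hleft (x : S) : x * p ∈ U := by
    have h : (1 - p) * x * p ∈ U := mem_of_sq_eq_zero U hU (by
      rw [show (1 - p) * x * p * ((1 - p) * x * p)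
        = (1 - p) * x * (p - p * p) * x * p by noncomm_ring, hp]; simp)
    have := U.add_mem (hcorner x) h
    rwa [show p * x * p + (1 - p) * x * p = x * p by noncomm_ring] at this
  have hright (x : S) : p * x ∈ U := by
    have h : p * x * (1 - p) ∈ U := mem_of_sq_eq_zero U hU (by
      rw [show p * x * (1 - p) * (p * x * (1 - p))
        = p * x * (p - p * p) * x * (1 - p) by noncomm_ring, hp]; simp)
    have := U.add_mem (hcorner x) h
    rwa [show p * x * p + p * x * (1 - p) = p * x by noncomm_ring] at this
  have := U.mul_mem (hleft s) (hright t)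
  rwa [show s * p * (p * t) = s * (p * p) * t by noncomm_ring, hp] at this

/-- In a von Neumann regular ring with a reduced corner `eSe`, every element of the corner has a
group inverse. -/
theorem exists_group_inverse_of_reduced_corner (hreg : ∀ s : S, ∃ t, s * t * s = s) {e : S}
    (he : e * e = e) (hred : ∀ y, e * y * e = y → y * y = 0 → y = 0)
    {c : S} (hc : e * c * e = c) :
    ∃ b f : S, c * b = f ∧ b * c = f ∧ f * c = c ∧ c * f = c ∧ b * f = b ∧ f * b = b := by
  have hec : e * c = c := by rw [← hc, ← mul_assoc, ← mul_assoc, he]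
  have hce : c * e = c := by rw [← hc, mul_assoc, he]
  have hcentral (f z : S) (hf : f * f = f) (hef : e * f = f) (hfe : f * e = f)
      (hez : e * z = z) (hze : z * e = z) : f * z = z * f := by
    have h1 : f * z - f * z * f = 0 := by
      apply hred
      · rw [show e * (f * z - f * z * f) * e = (e * f) * (z * e) - (e * f) * z * (f * e) by
          noncomm_ring, hef, hfe, hze]
      · rw [show (f * z - f * z * f) * (f * z - f * z * f)
          = f * z * (f * z) - f * z * (f * f) * z - f * z * (f * z) * f + f * z * (f * f) * z * f by
          noncomm_ring, hf]
        noncomm_ring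
    have h2 : z * f - f * z * f = 0 := by
      apply hred
      · rw [show e * (z * f - f * z * f) * e = (e * z) * (f * e) - (e * f) * z * (f * e) by
          noncomm_ring, hef, hfe, hez]
      · rw [show (z * f - f * z * f) * (z * f - f * z * f)
          = z * f * z * f - z * (f * f) * z * f - f * z * f * z * f + f * z * (f * f) * z * f by
          noncomm_ring, hf]
        noncomm_ring
    rw [sub_eq_zero.1 h1, sub_eq_zero.1 h2]
  obtain ⟨y₀, hy₀⟩ := hreg c
  obtain ⟨y, hy⟩ : ∃ y, y = e * y₀ * e := ⟨_, rfl⟩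
  have hey : e * y = y := by rw [hy, ← mul_assoc, ← mul_assoc, he]
  have hye : y * e = y := by rw [hy, mul_assoc, he]
  have hcyc : c * y * c = c := by
    rw [hy, show c * (e * y₀ * e) * c = (c * e) * y₀ * (e * c) by noncomm_ring, hce, hec, hy₀]
  have hf : (c * y) * (c * y) = c * y := by rw [← mul_assoc, hcyc]
  have hg : (y * c) * (y * c) = y * c := by rw [mul_assoc, ← mul_assoc c, hcyc]
  have hfc : (c * y) * y = y * (c * y) := hcentral _ _ hf (by rw [← mul_assoc, hec])
    (by rw [mul_assoc, hye]) hey hye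
  have hfc' : (c * y) * c = c * (c * y) := hcentral _ _ hf (by rw [← mul_assoc, hec])
    (by rw [mul_assoc, hye]) hec hce
  have hgc' : (y * c) * c = c * (y * c) := hcentral _ _ hg (by rw [← mul_assoc, hey])
    (by rw [mul_assoc, hce]) hec hce
  have hfg : c * y = y * c := by
    calc c * y = c * y * c * y := by rw [hcyc]
      _ = (y * c) * c * y := by rw [hgc']; noncomm_ring
      _ = y * (c * (c * y)) := by noncomm_ring
      _ = y * c := by rw [← hfc', hcyc]
  refine ⟨y * (c * y), c * y, ?_, ?_, hcyc, ?_, ?_, ?_⟩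
  · rw [← mul_assoc, hf]
  · rw [mul_assoc, hcyc, hfg]
  · rw [← hfc', hcyc]
  · rw [mul_assoc, hf]
  · rw [← mul_assoc, hfc, mul_assoc, hf]

theorem regular_of_units_mem (U : Subring S) (hU : ∀ s : S, IsUnit s → s ∈ U)
    (hreg : ∀ s : S, ∃ t, s * t * s = s) {p q e α β : S}
    (hp : p * p = p) (hq : q * q = q) (hpq : p * q = 0) (hqp : q * p = 0)
    (hsum : p + q + e = 1) (hβα : β * α = p) (hαβ : α * β = q)
    (hqα : q * α = α) (hαp : α * p = α) (hpβ : p * β = β) (hβq : β * q = β)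
    (hred : ∀ y, e * y * e = y → y * y = 0 → y = 0) {a : S} (ha : a ∈ U) :
    ∃ b ∈ U, a * b * a = a := by
  have he1 : 1 - e = p + q := by rw [← hsum]; abel
  have he : e * e = e := by
    rw [show e = 1 - (p + q) by rw [← he1]; abel]
    have : (p + q) * (p + q) = p + q := by
      rw [mul_add, add_mul, add_mul, hp, hq, hpq, hqp]; abel
    rw [show (1 - (p + q)) * (1 - (p + q)) = 1 - (p + q) - (p + q) + (p + q) * (p + q) by
      noncomm_ring, this]
    abel
  have hideal (s t : S) : s * (1 - e) * t ∈ U := by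
    rw [he1, mul_add, add_mul]
    exact U.add_mem (mul_mul_mem_of_equivalent U hU hp hpq hqp hβα hqα hαp hβq s t)
      (mul_mul_mem_of_equivalent U hU hq hqp hpq hαβ hpβ hβq hαp s t)
  have heU : e ∈ U := by
    have := U.sub_mem U.one_mem (hideal 1 1)
    rwa [show 1 - 1 * (1 - e) * 1 = e by noncomm_ring] at this
  obtain ⟨c, hcdef⟩ : ∃ c, c = e * a * e := ⟨_, rfl⟩
  have hcU : c ∈ U := hcdef ▸ U.mul_mem (U.mul_mem heU ha) heU
  obtain ⟨b, f, hcb, hbc, hfc, hcf, hbf, hfb⟩ :=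
    exists_group_inverse_of_reduced_corner hreg he hred (c := c)
      (by rw [hcdef, show e * (e * a * e) * e = (e * e) * a * (e * e) by noncomm_ring, he])
  have hff : f * f = f := by nth_rw 1 [← hcb]; rw [mul_assoc, hbf, hcb]
  have huv : (c + (1 - f)) * (b + (1 - f)) = 1 := by
    rw [show (c + (1 - f)) * (b + (1 - f))
      = c * b + (c - c * f) + (b - f * b) + (1 - f - f + f * f) by noncomm_ring,
      hcb, hcf, hfb, hff]
    abel
  have hvu : (b + (1 - f)) * (c + (1 - f)) = 1 := by
    rw [show (b + (1 - f)) * (c + (1 - f))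
      = b * c + (b - b * f) + (c - f * c) + (1 - f - f + f * f) by noncomm_ring,
      hbc, hbf, hfc, hff]
    abel
  have hfU : 1 - f ∈ U := by
    have := U.sub_mem (hU _ ⟨⟨_, _, huv, hvu⟩, rfl⟩) hcU
    simpa using this
  have hbU : b ∈ U := by
    have := U.sub_mem (hU _ ⟨⟨_, _, hvu, huv⟩, rfl⟩) hfU
    simpa using this
  obtain ⟨x, hx⟩ : ∃ x, x = a - a * b * a := ⟨_, rfl⟩
  obtain ⟨w, hw⟩ := hreg x
  have hcbc : c - c * b * c = 0 := by rw [hcb, hfc, sub_self]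
  have hz : w * x * w ∈ U := by
    obtain ⟨n, hn⟩ : ∃ n, n = a - c := ⟨_, rfl⟩
    have hnU (s t : S) : s * n * t ∈ U := by
      have := U.add_mem (hideal s (a * t)) (hideal (s * e * a) t)
      rwa [show s * (1 - e) * (a * t) + s * e * a * (1 - e) * t = s * n * t by
        rw [hn, hcdef]; noncomm_ring] at this
    have hexp : w * x * w = w * n * w - w * n * (b * c * w) - (w * c * b) * n * w
        - w * n * (b * n * w) + w * (c - c * b * c) * w := by
      rw [hx, show a = c + n by rw [hn]; abel]; noncomm_ring
    rw [hexp, hcbc, mul_zero, zero_mul, add_zero]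
    exact U.sub_mem (U.sub_mem (U.sub_mem (hnU _ _) (hnU _ _)) (hnU _ _)) (hnU _ _)
  refine ⟨b + (1 - b * a) * (w * x * w) * (1 - a * b),
    U.add_mem hbU (U.mul_mem (U.mul_mem (U.sub_mem U.one_mem (U.mul_mem hbU ha)) hz)
      (U.sub_mem U.one_mem (U.mul_mem ha hbU))), ?_⟩
  have hxzx : x * (w * x * w) * x = x := by
    rw [show x * (w * x * w) * x = (x * w * x) * w * x by noncomm_ring, hw, hw]
  rw [show a * (b + (1 - b * a) * (w * x * w) * (1 - a * b)) * a
    = a * b * a + (a - a * b * a) * (w * x * w) * (a - a * b * a) by noncomm_ring,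
    ← hx, hxzx, hx]
  abel

end RingTheory

section Injective

variable {R : Type u} {E : Type v} [Ring R] [AddCommGroup E] [Module R E]

theorem isEssential_of_forall_disjoint {N : Submodule R E}
    (h : ∀ K : Submodule R E, Disjoint N K → K = ⊥) : IsEssential N :=
  fun K hK hNK => hK (h K (disjoint_iff.2 hNK))

theorem IsEssential.eq_bot_of_disjoint {N K : Submodule R E} (hN : IsEssential N)
    (h : Disjoint N K) : K = ⊥ := by
  by_contra hK
  exact hN K hK h.eq_bot

theorem IsEssential.mono {N N' : Submodule R E} (hN : IsEssential N) (h : N ≤ N') :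
    IsEssential N' :=
  isEssential_of_forall_disjoint fun _ hK => hN.eq_bot_of_disjoint (hK.mono_left h)

theorem IsEssential.inf {N N' : Submodule R E} (hN : IsEssential N) (hN' : IsEssential N') :
    IsEssential (N ⊓ N') := fun K hK => by
  rw [inf_assoc]
  exact hN _ (hN' _ hK)

theorem IsEssential.comap {N : Submodule R E} (hN : IsEssential N) (f : Module.End R E) :
    IsEssential (N.comap f) := by
  refine isEssential_of_forall_disjoint fun K hK => ?_
  have hmap : K.map f = ⊥ := by
    refine hN.eq_bot_of_disjoint (Submodule.disjoint_def.2 ?_)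
    rintro _ hx ⟨k, hk, rfl⟩
    rw [Submodule.disjoint_def.1 hK k hx hk, map_zero]
  rw [← LinearMap.le_ker_iff_map] at hmap
  refine eq_bot_iff.2 (hK ?_ le_rfl)
  exact hmap.trans (fun x hx => by
    rw [Submodule.mem_comap, LinearMap.mem_ker.1 hx]; exact N.zero_mem)

/-- The two-sided ideal of endomorphisms with essential kernel. -/
def essentialKerIdeal (R : Type u) (E : Type v) [Ring R] [AddCommGroup E] [Module R E] :
    Ideal (Module.End R E) where
  carrier := {f | IsEssential (LinearMap.ker f)}
  zero_mem' := by
    change IsEssential _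
    rw [LinearMap.ker_zero]
    exact fun K hK => by rwa [top_inf_eq]
  add_mem' {f g} hf hg := (IsEssential.inf hf hg).mono fun x hx => by
    have h1 : f x = 0 := hx.1
    have h2 : g x = 0 := hx.2
    simp [h1, h2]
  smul_mem' f g hg := IsEssential.mono hg fun x hx => by
    have h1 : g x = 0 := hx
    simp [h1]

theorem mem_essentialKerIdeal {f : Module.End R E} :
    f ∈ essentialKerIdeal R E ↔ IsEssential (LinearMap.ker f) := Iff.rfl

instance : (essentialKerIdeal R E).IsTwoSided where
  mul_mem_of_left {_} g hf := IsEssential.comap hf g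

theorem mem_essentialKerIdeal_of_eqOn {N : Submodule R E} (hN : IsEssential N)
    {f : Module.End R E} (h : ∀ x ∈ N, f x = 0) : f ∈ essentialKerIdeal R E :=
  hN.mono h

theorem exists_maximal_of_pairwise {F : Type*} [AddCommGroup F] [Module R F] (p : F → F → Prop)
    {B : Submodule R F} (hB : ∀ x ∈ B, ∀ y ∈ B, p x y) :
    ∃ C, B ≤ C ∧ Maximal (fun G : Submodule R F => ∀ x ∈ G, ∀ y ∈ G, p x y) C := by
  refine zorn_le_nonempty₀ {G : Submodule R F | ∀ x ∈ G, ∀ y ∈ G, p x y} ?_ B hB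
  intro c hc hchain G hG
  refine ⟨sSup c, ?_, fun z hz => le_sSup hz⟩
  intro x hx y hy
  rw [Submodule.mem_sSup_of_directed ⟨G, hG⟩ hchain.directedOn] at hx hy
  obtain ⟨H, hH, hxH⟩ := hx
  obtain ⟨H', hH', hyH'⟩ := hy
  obtain ⟨L, hL, h1, h2⟩ := hchain.directedOn H hH H' hH'
  exact hc hL x (h1 hxH) y (h2 hyH')

theorem exists_maximal_disjoint {A B : Submodule R E} (h : Disjoint A B) :
    ∃ C, B ≤ C ∧ Maximal (Disjoint A) C := by
  obtain ⟨C, hBC, hC⟩ := exists_maximal_of_pairwise (fun x _ => x ∈ A → x = 0) (B := B)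
    fun x hx _ _ hxA => Submodule.disjoint_def.1 h x hxA hx
  have key (G : Submodule R E) : (∀ x ∈ G, ∀ y ∈ G, x ∈ A → x = 0) ↔ Disjoint A G :=
    ⟨fun h => Submodule.disjoint_def.2 fun x hxA hx => h x hx x hx hxA,
      fun h x hx _ _ hxA => Submodule.disjoint_def.1 h x hxA hx⟩
  simp only [key] at hC
  exact ⟨C, hBC, hC⟩

theorem isEssential_sup_of_maximal_disjoint {A C : Submodule R E}
    (hC : Maximal (Disjoint A) C) : IsEssential (A ⊔ C) := by
  refine isEssential_of_forall_disjoint fun K hK => ?_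
  have h : Disjoint A (C ⊔ K) := hC.prop.disjoint_sup_right_of_disjoint_sup_left hK
  have hKC : K ≤ C := le_sup_right.trans (hC.le_of_ge h le_sup_left)
  exact eq_bot_iff.2 (hK (hKC.trans le_sup_right) le_rfl)

variable (hE : Module.Injective R E)
include hE

theorem exists_extend_of_disjoint {A B : Submodule R E} (h : Disjoint A B) :
    ∃ f : Module.End R E, (∀ x ∈ A, f x = x) ∧ ∀ x ∈ B, f x = 0 := by
  obtain ⟨f, hf⟩ := hE.out (A.subtype.coprod B.subtype) (by
    rw [← LinearMap.ker_eq_bot, LinearMap.ker_coprod_of_disjoint_range]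
    · simp
    · simpa using h) (A.subtype.comp (LinearMap.fst R A B))
  exact ⟨f, fun x hx => by simpa using hf (⟨x, hx⟩, 0), fun x hx => by simpa using hf (0, ⟨x, hx⟩)⟩

/-- Disjoint submodules of an injective module are separated by an idempotent endomorphism. -/
theorem exists_idempotent_of_disjoint {A B : Submodule R E} (hAB : Disjoint A B) :
    ∃ f : Module.End R E, f * f = f ∧ (∀ x ∈ A, f x = x) ∧ (∀ x ∈ B, f x = 0) ∧
      Disjoint B (LinearMap.range f) := by
  obtain ⟨C, hAC, hC⟩ := exists_maximal_disjoint hAB.symm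
  obtain ⟨D, hBD, hD⟩ := exists_maximal_disjoint hC.prop.symm
  obtain ⟨f, hfC, hfD⟩ := exists_extend_of_disjoint hE hD.prop
  have hX : D.comap f ≤ D := hD.le_of_ge
    (Submodule.disjoint_def.2 fun x hxC hx => Submodule.disjoint_def.1 hD.prop x hxC (by
      rwa [Submodule.mem_comap, hfC x hxC] at hx))
    fun x hx => by rw [Submodule.mem_comap, hfD x hx]; exact D.zero_mem
  have hrange : Disjoint B (LinearMap.range f) := Submodule.disjoint_def.2 (by
    rintro _ hx ⟨x, rfl⟩
    exact hfD x (hX (hBD hx)))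
  have hle : LinearMap.range f ≤ C := hC.le_of_ge hrange fun x hx => ⟨x, hfC x hx⟩
  exact ⟨f, LinearMap.ext fun x => hfC _ (hle ⟨x, rfl⟩), fun x hx => hfC x (hAC hx),
    fun x hx => hfD x (hBD hx), hrange⟩

theorem isUnit_of_one_sub_mem {f : Module.End R E} (hf : 1 - f ∈ essentialKerIdeal R E) :
    IsUnit f := by
  have hfix (x : E) (hx : x ∈ LinearMap.ker (1 - f)) : f x = x := by
    have : x - f x = 0 := hx
    exact (sub_eq_zero.1 this).symm
  have hinj : Function.Injective f := by
    rw [← LinearMap.ker_eq_bot]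
    refine (mem_essentialKerIdeal.1 hf).eq_bot_of_disjoint (Submodule.disjoint_def.2 fun x hx h => ?_)
    rw [← hfix x hx]; exact h
  obtain ⟨g, hg⟩ := hE.out f hinj LinearMap.id
  have hginj : Function.Injective g := by
    rw [← LinearMap.ker_eq_bot]
    refine (mem_essentialKerIdeal.1 hf).eq_bot_of_disjoint (Submodule.disjoint_def.2 fun x hx h => ?_)
    have := hg x
    rw [hfix x hx] at this
    exact this.symm.trans h
  exact ⟨⟨f, g, LinearMap.ext fun x => hginj (hg (g x)), LinearMap.ext hg⟩, rfl⟩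

theorem isUnit_of_mul_sub_one_mem {f g : Module.End R E}
    (hfg : f * g - 1 ∈ essentialKerIdeal R E) (hgf : g * f - 1 ∈ essentialKerIdeal R E) :
    IsUnit f := by
  have h1 := isUnit_of_one_sub_mem hE (f := f * g) (by simpa using neg_mem hfg)
  have h2 := isUnit_of_one_sub_mem hE (f := g * f) (by simpa using neg_mem hgf)
  rw [Module.End.isUnit_iff] at h1 h2 ⊢
  exact ⟨Function.Injective.of_comp (f := g) h2.1, Function.Surjective.of_comp (g := g) h1.2⟩

theorem exists_sub_mul_mul_mem (a : Module.End R E) :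
    ∃ b : Module.End R E, a - a * b * a ∈ essentialKerIdeal R E := by
  obtain ⟨L, -, hL⟩ := exists_maximal_disjoint (disjoint_bot_right (a := LinearMap.ker a))
  obtain ⟨b, hb⟩ := hE.out (a.comp L.subtype) (by
    rw [← LinearMap.ker_eq_bot, eq_bot_iff]
    intro x hx
    exact Subtype.ext (Submodule.disjoint_def.1 hL.prop x hx x.2)) L.subtype
  refine ⟨b, mem_essentialKerIdeal_of_eqOn (isEssential_sup_of_maximal_disjoint hL) fun x hx => ?_⟩
  obtain ⟨y, hy, z, hz, rfl⟩ := Submodule.mem_sup.1 hx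
  have h1 : a y = 0 := hy
  have h2 : b (a z) = z := hb ⟨z, hz⟩
  simp [h1, h2]

theorem exists_idempotent_sub_mem {e : Module.End R E} (he : e * e - e ∈ essentialKerIdeal R E) :
    ∃ h : Module.End R E, h * h = h ∧ h - e ∈ essentialKerIdeal R E := by
  set K := LinearMap.ker (e * e - e)
  have hK (x : E) (hx : x ∈ K) : e (e x) = e x := sub_eq_zero.1 hx
  obtain ⟨h, hh, h1, h2, -⟩ := exists_idempotent_of_disjoint hE (A := K.map e) (B := K.map (1 - e))
    (Submodule.disjoint_def.2 (by
      rintro _ ⟨x, hx, rfl⟩ ⟨y, hy, hxy⟩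
      have hxy' : y - e y = e x := hxy
      rw [← hK x hx, ← hxy', map_sub, hK y hy, sub_self]))
  refine ⟨h, hh, mem_essentialKerIdeal_of_eqOn (N := K) he fun x hx => ?_⟩
  have h3 := h1 _ ⟨x, hx, rfl⟩
  have h4 : h (x - e x) = 0 := h2 _ ⟨x, hx, rfl⟩
  rw [map_sub, h3] at h4
  exact h4

end Injective

section Decomposition

variable {R : Type u} {E : Type v} [Ring R] [AddCommGroup E] [Module R E]

/-- The graph condition for an isomorphism between two disjoint submodules of `E`. -/
def IsDisjointIsoGraph (G : Submodule R (E × E)) : Prop :=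
  ∀ x ∈ G, ∀ y ∈ G, x.1 = y.2 → x = 0 ∧ y = 0

theorem exists_maximal_isDisjointIsoGraph (R : Type u) (E : Type v) [Ring R] [AddCommGroup E]
    [Module R E] : ∃ G : Submodule R (E × E), Maximal IsDisjointIsoGraph G := by
  obtain ⟨G, -, hG⟩ := exists_maximal_of_pairwise (R := R) (F := E × E)
    (fun x y => x.1 = y.2 → x = 0 ∧ y = 0) (B := ⊥) (by
      rintro x hx y hy -
      exact ⟨(Submodule.mem_bot R).1 hx, (Submodule.mem_bot R).1 hy⟩)
  exact ⟨G, hG⟩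

/-- The sum of the domain and the range of the isomorphism with graph `G`. -/
def graphSum (G : Submodule R (E × E)) : Submodule R E :=
  G.map (LinearMap.fst R E E) ⊔ G.map (LinearMap.snd R E E)

theorem fst_mem_graphSum {G : Submodule R (E × E)} {x : E × E} (hx : x ∈ G) :
    x.1 ∈ graphSum G := Submodule.mem_sup_left ⟨x, hx, rfl⟩

theorem snd_mem_graphSum {G : Submodule R (E × E)} {x : E × E} (hx : x ∈ G) :
    x.2 ∈ graphSum G := Submodule.mem_sup_right ⟨x, hx, rfl⟩

/-- A submodule disjoint from a maximal pair of disjoint isomorphic submodules is square-free. -/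
theorem eq_bot_of_maximal_isDisjointIsoGraph {G : Submodule R (E × E)}
    (hG : Maximal IsDisjointIsoGraph G) {D Z : Submodule R E} (hD : Disjoint (graphSum G) D)
    (f : Module.End R E) (hZD : Z ≤ D) (hfD : ∀ z ∈ Z, f z ∈ D) (hf : ∀ z ∈ Z, f z = 0 → z = 0)
    (hZ : ∀ z ∈ Z, f z ∈ Z → f z = 0) : Z = ⊥ := by
  obtain ⟨G', hG'⟩ : ∃ G', G' = G ⊔ Z.map (LinearMap.id.prod f) := ⟨_, rfl⟩
  have hiso : IsDisjointIsoGraph G' := by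
    intro u hu v hv huv
    rw [hG'] at hu hv
    obtain ⟨x, hx, _, ⟨z, hz, rfl⟩, rfl⟩ := Submodule.mem_sup.1 hu
    obtain ⟨y, hy, _, ⟨w, hw, rfl⟩, rfl⟩ := Submodule.mem_sup.1 hv
    have huv' : x.1 + z = y.2 + f w := huv
    have h1 : x.1 - y.2 = f w - z := by
      rw [sub_eq_sub_iff_add_eq_add, huv', add_comm]
    have h2 : x.1 - y.2 = 0 := Submodule.disjoint_def.1 hD _
      ((graphSum G).sub_mem (fst_mem_graphSum hx) (snd_mem_graphSum hy))
      (h1 ▸ D.sub_mem (hfD w hw) (hZD hz))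
    obtain ⟨rfl, rfl⟩ := hG.prop x hx y hy (sub_eq_zero.1 h2)
    have h3 : f w = z := sub_eq_zero.1 (h1 ▸ h2)
    have h4 : f w = 0 := hZ w hw (h3 ▸ hz)
    have h5 : w = 0 := hf w hw h4
    have h6 : z = 0 := h3 ▸ h4
    subst h5 h6
    simp
  have hle : G' ≤ G := hG.le_of_ge hiso (hG' ▸ le_sup_left)
  refine eq_bot_iff.2 fun z hz => Submodule.disjoint_def.1 hD z ?_ (hZD hz)
  have hmem : (z, f z) ∈ G := hle (hG' ▸ Submodule.mem_sup_right ⟨z, hz, rfl⟩)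
  exact fst_mem_graphSum hmem

/-- The canonical map from `G × G × D` to `E`, summing domain, range and `D`. -/
def graphSumMap (G : Submodule R (E × E)) (D : Submodule R E) : (G × G × D) →ₗ[R] E :=
  ((LinearMap.fst R E E).comp G.subtype).coprod
    (((LinearMap.snd R E E).comp G.subtype).coprod D.subtype)

theorem graphSumMap_apply (G : Submodule R (E × E)) (D : Submodule R E) (x y : G) (d : D) :
    graphSumMap G D (x, y, d) = (x : E × E).1 + ((y : E × E).2 + d) := rfl

theorem graphSumMap_injective {G : Submodule R (E × E)} (hG : IsDisjointIsoGraph G)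
    {D : Submodule R E} (hD : Disjoint (graphSum G) D) :
    Function.Injective (graphSumMap G D) := by
  rw [← LinearMap.ker_eq_bot, eq_bot_iff]
  rintro ⟨x, y, d⟩ h
  have h : (x : E × E).1 + ((y : E × E).2 + d) = 0 := h
  have hd : (d : E) = 0 := Submodule.disjoint_def.1 hD _ (by
    rw [show (d : E) = -((x : E × E).1 + (y : E × E).2) by
      rw [eq_neg_iff_add_eq_zero, ← h]; abel]
    exact (graphSum G).neg_mem
      ((graphSum G).add_mem (fst_mem_graphSum x.2) (snd_mem_graphSum y.2))) d.2
  rw [hd, add_zero] at h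
  obtain ⟨h1, h2⟩ := hG x x.2 (-y) (G.neg_mem y.2) (eq_neg_of_add_eq_zero_left h)
  rw [neg_eq_zero] at h2
  exact Prod.ext (Subtype.ext h1) (Prod.ext (Subtype.ext h2) (Subtype.ext hd))

theorem range_graphSumMap (G : Submodule R (E × E)) (D : Submodule R E) :
    LinearMap.range (graphSumMap G D) = graphSum G ⊔ D := by
  rw [graphSumMap, LinearMap.range_coprod, LinearMap.range_coprod, LinearMap.range_comp,
    LinearMap.range_comp, Submodule.range_subtype, Submodule.range_subtype, graphSum, sup_assoc]

theorem exists_sub_mul_mul_mem_of_units_mem (hE : Module.Injective R E)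
    {T : Subring (Module.End R E)} (hT : ∀ f : Module.End R E, IsUnit f → f ∈ T)
    {a : Module.End R E} (ha : a ∈ T) :
    ∃ b ∈ T, a - a * b * a ∈ essentialKerIdeal R E := by
  obtain ⟨G, hG⟩ := exists_maximal_isDisjointIsoGraph R E
  obtain ⟨D, -, hD⟩ := exists_maximal_disjoint (disjoint_bot_right (a := graphSum G))
  obtain ⟨e, he, heD, heG, hedisj⟩ := exists_idempotent_of_disjoint hE hD.prop.symm
  have hess : IsEssential (LinearMap.range (graphSumMap G D)) := by
    rw [range_graphSumMap]
    exact isEssential_sup_of_maximal_disjoint hD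
  have hinj := graphSumMap_injective hG.prop hD.prop
  obtain ⟨p, hp⟩ := hE.out _ hinj
    (((LinearMap.fst R E E).comp G.subtype).comp (LinearMap.fst R G (G × D)))
  obtain ⟨q, hq⟩ := hE.out _ hinj
    (((LinearMap.snd R E E).comp G.subtype).comp
      ((LinearMap.fst R G D).comp (LinearMap.snd R G (G × D))))
  obtain ⟨α, hα⟩ := hE.out _ hinj
    (((LinearMap.snd R E E).comp G.subtype).comp (LinearMap.fst R G (G × D)))
  obtain ⟨β, hβ⟩ := hE.out _ hinj
    (((LinearMap.fst R E E).comp G.subtype).comp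
      ((LinearMap.fst R G D).comp (LinearMap.snd R G (G × D))))
  have hx (x : G) : graphSumMap G D (x, 0, 0) = (x : E × E).1 := by simp [graphSumMap_apply]
  have hy (y : G) : graphSumMap G D (0, y, 0) = (y : E × E).2 := by simp [graphSumMap_apply]
  have hfst (f : Module.End R E) {g : (G × G × D) →ₗ[R] E} (hf : ∀ z, f (graphSumMap G D z) = g z) (x : G) :
    f (x : E × E).1 = g (x, 0, 0) := by rw [← hx, hf]
  have hsnd (f : Module.End R E) {g : (G × G × D) →ₗ[R] E} (hf : ∀ z, f (graphSumMap G D z) = g z) (y : G) :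
    f (y : E × E).2 = g (0, y, 0) := by rw [← hy, hf]
  let I := essentialKerIdeal R E
  let π := Ideal.Quotient.mk I
  have hπ {f g : Module.End R E}
      (h : ∀ z, f (graphSumMap G D z) = g (graphSumMap G D z)) : π f = π g :=
    Ideal.Quotient.eq.2 (mem_essentialKerIdeal_of_eqOn hess (by
      rintro _ ⟨z, rfl⟩
      exact sub_eq_zero.2 (h z)))
  have hsurj : Function.Surjective π := Ideal.Quotient.mk_surjective
  have hunits (s : Module.End R E ⧸ I) (hs : IsUnit s) : s ∈ T.map π := by
    obtain ⟨⟨s, t, hst, hts⟩, rfl⟩ := hs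
    obtain ⟨f, rfl⟩ := hsurj s
    obtain ⟨g, rfl⟩ := hsurj t
    rw [← map_mul, ← map_one π] at hst hts
    exact ⟨f, hT f (isUnit_of_mul_sub_one_mem hE (Ideal.Quotient.eq.1 hst)
      (Ideal.Quotient.eq.1 hts)), rfl⟩
  have hreg (s : Module.End R E ⧸ I) : ∃ t, s * t * s = s := by
    obtain ⟨f, rfl⟩ := hsurj s
    obtain ⟨g, hg⟩ := exists_sub_mul_mul_mem hE f
    refine ⟨π g, ?_⟩
    rw [← map_mul, ← map_mul]
    exact (Ideal.Quotient.eq.2 hg).symm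
  have hred (y : Module.End R E ⧸ I) (hy : π e * y * π e = y) (hyy : y * y = 0) : y = 0 := by
    obtain ⟨f₀, rfl⟩ := hsurj y
    obtain ⟨f, hf⟩ : ∃ f, f = e * f₀ * e := ⟨_, rfl⟩
    rw [← map_mul, ← map_mul, ← hf] at hy
    rw [← hy, ← map_mul] at hyy
    rw [← hy]
    have hef : e * f = f := by rw [hf, ← mul_assoc, ← mul_assoc, he]
    have hfe : f * e = f := by rw [hf, mul_assoc, he]
    have hfe' (x : E) : f (e x) = f x := LinearMap.congr_fun hfe x
    refine Ideal.Quotient.eq_zero_iff_mem.2 (isEssential_of_forall_disjoint fun L hL => ?_)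
    refine (mem_essentialKerIdeal.1 (Ideal.Quotient.eq_zero_iff_mem.1 hyy)).eq_bot_of_disjoint
      (Submodule.disjoint_def.2 fun x hxff hxL => ?_)
    let Z := (L ⊓ LinearMap.ker (f * f)).map e
    have hff (z : E) (hz : z ∈ LinearMap.ker (f * f)) : f (f z) = 0 := hz
    have hZ : Z = ⊥ := by
      refine eq_bot_of_maximal_isDisjointIsoGraph hG hedisj f LinearMap.map_le_range ?_ ?_ ?_
      · rintro z -
        rw [← hef]
        exact ⟨f z, rfl⟩
      · rintro _ ⟨z, hz, rfl⟩ h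
        rw [hfe'] at h
        rw [Submodule.disjoint_def.1 hL z h hz.1, map_zero]
      · rintro _ ⟨z, hz, rfl⟩ ⟨w, hw, hwz⟩
        have h : f w = 0 := by rw [← hfe', hwz, hfe', hff z hz.2]
        rw [← hwz, Submodule.disjoint_def.1 hL w h hw.1, map_zero]
    have hex : e x = 0 := (Submodule.mem_bot R).1 (hZ ▸ ⟨x, ⟨hxL, hxff⟩, rfl⟩)
    refine Submodule.disjoint_def.1 hL x ?_ hxL
    rw [LinearMap.mem_ker, ← hfe', hex, map_zero]
  have hmul {f g h : Module.End R E}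
      (H : ∀ z, f (g (graphSumMap G D z)) = h (graphSumMap G D z)) : π f * π g = π h := by
    rw [← map_mul]; exact hπ H
  obtain ⟨b, ⟨b, hb, rfl⟩, hab⟩ := regular_of_units_mem (T.map π) hunits hreg
    (p := π p) (q := π q) (e := π e) (α := π α) (β := π β)
    (hmul fun z => by rw [hp]; exact hfst p hp z.1)
    (hmul fun z => by rw [hq]; exact hsnd q hq z.2.1)
    (by
      rw [← map_zero π]
      exact hmul fun z => by rw [hq]; exact hsnd p hp z.2.1)
    (by
      rw [← map_zero π]
      exact hmul fun z => by rw [hp]; exact hfst q hq z.1)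
    (by
      rw [← map_add, ← map_add, ← map_one π]
      refine hπ fun z => ?_
      obtain ⟨x, y, d⟩ := z
      have h1 : e (graphSumMap G D (x, y, d)) = d := by
        rw [graphSumMap_apply, map_add, map_add, heG _ (fst_mem_graphSum x.2),
          heG _ (snd_mem_graphSum y.2), heD _ d.2, zero_add, zero_add]
      rw [LinearMap.add_apply, LinearMap.add_apply, h1, hp, hq]
      exact add_assoc _ _ _)
    (hmul fun z => by rw [hα, hp]; exact hsnd β hβ z.1)
    (hmul fun z => by rw [hβ, hq]; exact hfst α hα z.2.1)
    (hmul fun z => by rw [hα]; exact hsnd q hq z.1)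
    (hmul fun z => by rw [hp, hα]; exact hfst α hα z.1)
    (hmul fun z => by rw [hβ]; exact hfst p hp z.2.1)
    (hmul fun z => by rw [hq, hβ]; exact hsnd β hβ z.2.1)
    hred (a := π a) ⟨a, ha, rfl⟩
  refine ⟨b, hb, Ideal.Quotient.eq.1 ?_⟩
  rw [map_mul, map_mul, hab]

end Decomposition

section Exchange

theorem exists_idempotent_of_sub_mul_mul_mem {S : Type*} [Ring S] {T : Subring S} {I : Ideal S}
    [I.IsTwoSided] (hIT : ∀ s ∈ I, s ∈ T) (hunit : ∀ s ∈ I, IsUnit (1 + s))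
    (hT : ∀ s : S, IsUnit s → s ∈ T)
    (hlift : ∀ e : S, e * e - e ∈ I → ∃ h, h * h = h ∧ h - e ∈ I)
    {a b : S} (ha : a ∈ T) (hb : b ∈ T) (hab : a - a * b * a ∈ I) :
    ∃ e, ∃ r ∈ T, ∃ s ∈ T, e * e = e ∧ e = r * a ∧ 1 - e = s * (1 - a) := by
  obtain ⟨g, hg⟩ : ∃ g, g = b * a := ⟨_, rfl⟩
  have hgT : g ∈ T := hg ▸ T.mul_mem hb ha
  obtain ⟨e, he⟩ : ∃ e, e = g + (1 - g) * a := ⟨_, rfl⟩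
  have hea : e = (b + (1 - g)) * a := by rw [he, hg]; noncomm_ring
  have hea' : 1 - e = (1 - g) * (1 - a) := by rw [he]; noncomm_ring
  have heT : e ∈ T := he ▸ T.add_mem hgT (T.mul_mem (T.sub_mem T.one_mem hgT) ha)
  have hee : e * e - e ∈ I := by
    have h1 : a - a * g ∈ I := by rwa [hg, ← mul_assoc]
    have h2 : g - g * g ∈ I := by
      have := I.mul_mem_left b h1
      rwa [show b * (a - a * g) = g - g * g by rw [hg]; noncomm_ring] at this
    have h3 : e - e * g ∈ I := by
      have := I.add_mem h2 (I.mul_mem_left (1 - g) h1)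
      rwa [show g - g * g + (1 - g) * (a - a * g) = e - e * g by rw [he]; noncomm_ring] at this
    have h4 : g * e - g ∈ I := by
      have := I.mul_mem_right (a - 1) h2
      rwa [show (g - g * g) * (a - 1) = g * e - g by rw [he]; noncomm_ring] at this
    have := I.sub_mem (I.add_mem (I.mul_mem_right e h3) (I.mul_mem_left e h4)) h3
    rwa [show (e - e * g) * e + e * (g * e - g) - (e - e * g) = e * e - e by noncomm_ring] at this
  obtain ⟨h, hh, hhe⟩ := hlift e hee
  have hunitT {s t : S} (hst : (1 + s) * t = 1) (hts : t * (1 + s) = 1) : t ∈ T :=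
    hT t ⟨⟨t, 1 + s, hts, hst⟩, rfl⟩
  have hinvI {s t : S} (hs : s ∈ I) (hts : t * (1 + s) = 1) : t - 1 ∈ I := by
    have := I.neg_mem (I.mul_mem_left t hs)
    rwa [show -(t * s) = t - t * (1 + s) by noncomm_ring, hts] at this
  have hhT : h ∈ T := by simpa using T.add_mem (hIT _ hhe) heT
  -- First conjugate the lift into `T * e`.
  obtain ⟨⟨u, u', huu', hu'u⟩, hu⟩ := hunit (e - h) (by simpa using I.neg_mem hhe)
  obtain rfl : u = 1 + (e - h) := hu
  have hu'T := hunitT huu' hu'u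
  have hu'I := hinvI (by simpa using I.neg_mem hhe) hu'u
  obtain ⟨k, hk⟩ : ∃ k, k = u' * (h * (1 + (e - h))) := ⟨_, rfl⟩
  have hke : k = u' * h * e := by
    rw [hk, show h * (1 + (e - h)) = h * e + (h - h * h) by noncomm_ring, hh]; noncomm_ring
  have hkk : k * k = k := by
    rw [hk, show u' * (h * (1 + (e - h))) * (u' * (h * (1 + (e - h))))
      = u' * h * ((1 + (e - h)) * u') * h * (1 + (e - h)) by noncomm_ring, huu',
      show u' * h * 1 * h * (1 + (e - h)) = u' * (h * h * (1 + (e - h))) by noncomm_ring, hh]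
  have hkI : k - e ∈ I := by
    have := I.add_mem (I.mul_mem_right (h * e) hu'I)
      (I.add_mem (I.mul_mem_right e hhe) hee)
    rwa [show (u' - 1) * (h * e) + ((h - e) * e + (e * e - e)) = u' * h * e - e by noncomm_ring,
      ← hke] at this
  have hkT : k ∈ T := hke ▸ T.mul_mem (T.mul_mem hu'T hhT) heT
  -- Then conjugate its complement into `T * (1 - e)`.
  obtain ⟨⟨v, v', hvv', hv'v⟩, hv⟩ := hunit (k - e) hkI
  obtain rfl : v = 1 + (k - e) := hv
  have hv'T := hunitT hvv' hv'v
  obtain ⟨l, hl⟩ : ∃ l, l = v' * (k * (1 + (k - e))) := ⟨_, rfl⟩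
  have hle : l = v' * (2 * u' * h - k) * e := by
    rw [hl, show k * (1 + (k - e)) = k + k * k - k * e by noncomm_ring, hkk]
    nth_rw 1 2 [hke]
    noncomm_ring
  have hl1 : 1 - l = v' * (1 - k) * (1 - e) := by
    have h1 : 1 - l = v' * (1 + (k - e)) - l := by rw [hv'v]
    rw [h1, hl, show v' * (1 + (k - e)) - v' * (k * (1 + (k - e)))
      = v' * (1 - e + (k * e - k * k)) by noncomm_ring, hkk]
    noncomm_ring
  have hll : l * l = l := by
    rw [hl, show v' * (k * (1 + (k - e))) * (v' * (k * (1 + (k - e))))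
      = v' * k * ((1 + (k - e)) * v') * k * (1 + (k - e)) by noncomm_ring, hvv',
      show v' * k * 1 * k * (1 + (k - e)) = v' * (k * k * (1 + (k - e))) by noncomm_ring, hkk]
  have h2T : (2 : S) ∈ T := by
    rw [← one_add_one_eq_two]; exact T.add_mem T.one_mem T.one_mem
  refine ⟨l, v' * (2 * u' * h - k) * (b + (1 - g)),
    T.mul_mem (T.mul_mem hv'T (T.sub_mem (T.mul_mem (T.mul_mem h2T hu'T) hhT) hkT))
      (T.add_mem hb (T.sub_mem T.one_mem hgT)),
    v' * (1 - k) * (1 - g),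
    T.mul_mem (T.mul_mem hv'T (T.sub_mem T.one_mem hkT)) (T.sub_mem T.one_mem hgT), hll, ?_, ?_⟩
  · rw [hle, mul_assoc _ (b + (1 - g)) a, ← hea]
  · rw [hl1, hea', mul_assoc (v' * (1 - k))]

/-- In an exchange ring, any decomposition of an idempotent `f` inside `S f` refines to orthogonal
idempotents in the corresponding left ideals. -/
theorem exists_orthogonal_idempotents {S : Type*} [Ring S]
    (hS : ∀ a : S, ∃ e r s : S, e * e = e ∧ e = r * a ∧ 1 - e = s * (1 - a)) (n : ℕ) :
    ∀ (f : S) (a : Fin n → S), f * f = f → (∀ i, a i * f = a i) →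
      ∑ i, a i = f → ∃ e r : Fin n → S, (∀ i, e i = r i * a i) ∧ (∀ i, e i * e i = e i) ∧
        (∀ i j, i ≠ j → e i * e j = 0) ∧ (∀ i, f * e i = e i) ∧ ∑ i, e i = f := by
  induction n with
  | zero => exact fun f a _ _ h => ⟨a, 0, by simp, by simp, by simp, by simp, h⟩
  | succ n ih =>
    intro f a hf haf hsum
    rw [Fin.sum_univ_succ] at hsum
    -- Split off the first summand inside the corner.
    obtain ⟨e₀, r₀, s₀, he₀, hr₀, hs₀⟩ := hS (a 0)
    have he₀f : e₀ * f = e₀ := by rw [hr₀, mul_assoc, haf]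
    obtain ⟨e, he⟩ : ∃ e, e = f * e₀ := ⟨_, rfl⟩
    have hee : e * e = e := by
      rw [he, show f * e₀ * (f * e₀) = f * ((e₀ * f) * e₀) by noncomm_ring, he₀f, he₀]
    have hfe : f * e = e := by rw [he, ← mul_assoc, hf]
    have hef : e * f = e := by rw [he, mul_assoc, he₀f]
    have her : e = f * r₀ * a 0 := by rw [he, hr₀, mul_assoc]
    obtain ⟨g, hg⟩ : ∃ g, g = f - e := ⟨_, rfl⟩
    have hgg : g * g = g := by
      rw [hg, show (f - e) * (f - e) = f * f - f * e - e * f + e * e by noncomm_ring,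
        hf, hfe, hef, hee]
      abel
    have hfg : f * g = g := by rw [hg, mul_sub, hf, hfe]
    obtain ⟨t, ht⟩ : ∃ t, t = f * s₀ := ⟨_, rfl⟩
    have hgt : g = t * ∑ i : Fin n, a i.succ := by
      have h1 : ∑ i : Fin n, a i.succ = f - a 0 := by rw [← hsum]; abel
      have h2 : g = f * (1 - e₀) * f := by
        rw [hg, he, mul_assoc, sub_mul, he₀f, mul_sub, one_mul, hf]
      rw [h1, h2, hs₀, ht, show f * (s₀ * (1 - a 0)) * f = f * s₀ * (f - a 0 * f) by noncomm_ring,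
        haf]
    -- Decompose the complementary idempotent `g`.
    obtain ⟨e', r', her', hee', horth', hge', hsum'⟩ := ih g (fun i => g * t * a i.succ * g) hgg
      (fun i => by rw [mul_assoc, hgg])
      (by
        rw [← Finset.sum_mul, ← Finset.mul_sum, mul_assoc g, ← hgt, hgg, hgg])
    let φ : Fin n → S := fun i => e' i * r' i * (g * t) * a i.succ
    have hφf (i) : φ i * f = φ i := by simp only [φ]; rw [mul_assoc, haf]
    have hφg (i) : φ i * g = e' i := by
      have h1 : φ i * g = e' i * (r' i * (g * t * a i.succ * g)) := by
        simp only [φ]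
        noncomm_ring
      rw [h1, ← her', hee']
    have he'φ (i) : e' i * φ i = φ i := by
      simp only [φ, ← mul_assoc]
      rw [hee']
    have hgφ (i) : g * φ i = φ i := by rw [← he'φ, ← mul_assoc, hge']
    have hφe' (i j) : φ i * e' j = e' i * e' j := by rw [← hge' j, ← mul_assoc, hφg, hge']
    have hφφ (i j) : φ i * φ j = e' i * φ j := by
      rw [← he'φ j, ← mul_assoc, hφe', mul_assoc]
    let h : S := ∑ i, φ i
    have hhg : h * g = g := by
      simp only [h, Finset.sum_mul, hφg, hsum']
    have hgh : g * h = h := by simp only [h, Finset.mul_sum, hgφ]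
    have hfh : f * h = h := by rw [← hgh, ← mul_assoc, hfg]
    have hhf : h * f = h := by simp only [h, Finset.sum_mul, hφf]
    have hhh : h * h = h := by
      nth_rw 2 [← hgh]
      rw [← mul_assoc, hhg, hgh]
    have hφh (i) : φ i * h = φ i := by
      simp only [h, Finset.mul_sum, hφφ]
      rw [Finset.sum_eq_single i, he'φ]
      · intro j _ hji
        rw [← he'φ j, ← mul_assoc, horth' i j hji.symm, zero_mul]
      · simp
    have hhφ (i) : h * φ i = φ i := by rw [← hgφ i, ← mul_assoc, hhg]
    have hlast : f - h = (f - h) * e := by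
      have h1 : (f - h) * g = 0 := by rw [sub_mul, hfg, hhg, sub_self]
      have h2 : (f - h) * f = f - h := by rw [sub_mul, hf, hhf]
      rw [hg, mul_sub, h2] at h1
      exact sub_eq_zero.1 h1
    refine ⟨Fin.cons (f - h) φ, Fin.cons ((f - h) * (f * r₀)) fun i => e' i * r' i * (g * t),
      ?_, ?_, ?_, ?_, ?_⟩
    · refine Fin.cases ?_ fun i => rfl
      simp only [Fin.cons_zero]
      nth_rw 1 [hlast, her]
      noncomm_ring
    · refine Fin.cases ?_ fun i => ?_
      · simp only [Fin.cons_zero]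
        rw [sub_mul, mul_sub, mul_sub, hf, hfh, hhf, hhh]
        abel
      · simp only [Fin.cons_succ]
        rw [hφφ, he'φ]
    · refine Fin.cases (Fin.cases (fun h => absurd rfl h) fun j _ => ?_)
        fun i => Fin.cases (fun _ => ?_) fun j hij => ?_
      · simp only [Fin.cons_zero, Fin.cons_succ]
        rw [sub_mul, hhφ, ← hgφ, ← mul_assoc, hfg, sub_self]
      · simp only [Fin.cons_zero, Fin.cons_succ]
        rw [mul_sub, hφf, hφh, sub_self]
      · simp only [Fin.cons_succ]
        rw [hφφ, ← he'φ j, ← mul_assoc, horth' i j (fun h => hij (congrArg _ h)), zero_mul]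
    · refine Fin.cases ?_ fun i => ?_
      · simp only [Fin.cons_zero]
        rw [mul_sub, hf, hfh]
      · simp only [Fin.cons_succ]
        rw [← hgφ, ← mul_assoc, hfg]
    · rw [Fin.sum_univ_succ]
      simp only [Fin.cons_zero, Fin.cons_succ]
      exact sub_add_cancel f h

end Exchange

section Modules

theorem finiteExchange_of_exchange_end {R : Type u} [Ring R] {M : Type v} [AddCommGroup M]
    [Module R M] (hS : ∀ a : Module.End R M, ∃ e r s : Module.End R M,
      e * e = e ∧ e = r * a ∧ 1 - e = s * (1 - a)) : FiniteExchange R M := by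
  intro A _ _ n Mp N Ai hMN ⟨σ⟩ hind htop
  let Φ := hind.linearEquiv htop
  let π (i : Fin n) : A →ₗ[R] A :=
    (Ai i).subtype.comp ((DFinsupp.lapply i).comp Φ.symm.toLinearMap)
  have hπmem (i : Fin n) (x : A) : π i x ∈ Ai i := (Φ.symm x i).2
  have hπself (i : Fin n) {x : A} (hx : x ∈ Ai i) : π i x = x := by
    change ((Φ.symm x i : Ai i) : A) = x
    rw [hind.linearEquiv_symm_apply htop hx]
    simp
  have hπne {i j : Fin n} (hij : i ≠ j) {x : A} (hx : x ∈ Ai i) : π j x = 0 := by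
    change ((Φ.symm x j : Ai j) : A) = 0
    rw [hind.linearEquiv_symm_apply htop hx]
    rw [DFinsupp.single_apply, dif_neg hij]
    rfl
  have hπsum (x : A) : ∑ i, π i x = x := by
    have hx : x ∈ iSup Ai := htop ▸ Submodule.mem_top
    induction hx using Submodule.iSup_induction' with
    | mem i x hx =>
      rw [Finset.sum_eq_single i (fun j _ hj => hπne hj.symm hx) (by simp), hπself i hx]
    | zero => simp
    | add x y _ _ hx hy => simp only [map_add, Finset.sum_add_distrib, hx, hy]
  let p : A →ₗ[R] M := σ.toLinearMap.comp (Mp.projectionOnto N hMN)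
  let ι : M →ₗ[R] A := Mp.subtype.comp σ.symm.toLinearMap
  have hpι (m : M) : p (ι m) = m := by simp [p, ι]
  have hιp {x : A} (hx : x ∈ Mp) : ι (σ ⟨x, hx⟩) = x := by simp [ι]
  have hιmem (m : M) : ι m ∈ Mp := (σ.symm m).2
  obtain ⟨e, r, her, hee, horth, -, hsum⟩ := exists_orthogonal_idempotents hS n 1
    (fun i => p.comp ((π i).comp ι)) (one_mul 1) (fun i => mul_one _) (by
      refine LinearMap.ext fun m => ?_
      simp only [LinearMap.sum_apply, LinearMap.comp_apply, ← map_sum, hπsum, hpι,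
        Module.End.one_apply])
  let ψ (i : Fin n) : A →ₗ[R] M := (e i * r i).comp (p.comp (π i))
  let φ : A →ₗ[R] M := ∑ i, ψ i
  have hφ (x : A) : φ x = ∑ i, ψ i x := LinearMap.sum_apply _ _ _
  have hψι (i : Fin n) (m : M) : ψ i (ι m) = e i m := by
    have h : ψ i (ι m) = (e i * (r i * p.comp ((π i).comp ι))) m := rfl
    rw [h, ← her, hee]
  have hφι (m : M) : φ (ι m) = m := by
    simp only [hφ, hψι]
    rw [← LinearMap.sum_apply, hsum, Module.End.one_apply]
  have heψ (i j : Fin n) (x : A) : e i (ψ j x) = if i = j then ψ j x else 0 := by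
    change (e i * (e j * r j)) (p (π j x)) = _
    rw [← mul_assoc]
    split_ifs with h
    · rw [h, hee]; rfl
    · rw [horth i j h, zero_mul]; rfl
  have heφ (i : Fin n) (x : A) : e i (φ x) = ψ i x := by simp [hφ, heψ]
  have hφmem (i : Fin n) {x : A} (hx : x ∈ Ai i) : φ x = ψ i x := by
    rw [hφ]
    refine Finset.sum_eq_single i (fun j _ hj => ?_) (by simp)
    change (e j * r j) (p (π j x)) = 0
    rw [hπne hj.symm hx, map_zero, map_zero]
  have hψπ (i : Fin n) (x : A) : ψ i (π i x) = ψ i x := by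
    change (e i * r i) (p (π i (π i x))) = (e i * r i) (p (π i x))
    rw [hπself i (hπmem i x)]
  refine ⟨fun i => Ai i ⊓ LinearMap.ker φ, fun i => inf_le_left, ?_, ?_⟩
  · rw [iSupIndep_iff_finsetSum_eq_zero_imp_eq_zero]
    intro s v hv hsum0
    let w (i : Fin (n + 1)) : A := if i ∈ s then v i else 0
    have hw (i) : w i ∈ (Fin.cons Mp fun i => Ai i ⊓ LinearMap.ker φ :
        Fin (n + 1) → Submodule R A) i := by
      simp only [w]
      split_ifs with h
      · exact hv i h
      · exact Submodule.zero_mem _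
    have hw0 : w 0 + ∑ i : Fin n, w i.succ = 0 := by
      rw [← Fin.sum_univ_succ, ← hsum0]
      simp [w]
    have hwMp : w 0 ∈ Mp := hw 0
    have hwAi (i : Fin n) : w i.succ ∈ Ai i ⊓ LinearMap.ker φ := hw i.succ
    have hzero : w 0 = 0 := by
      have h1 := congrArg φ hw0
      rw [map_add, map_sum, Finset.sum_eq_zero (fun i _ => (hwAi i).2), add_zero, map_zero,
        ← hιp hwMp, hφι] at h1
      rw [← hιp hwMp, h1, map_zero]
    rw [hzero, zero_add] at hw0
    have hsucc := (iSupIndep_iff_finsetSum_eq_zero_imp_eq_zero Ai).1 hind Finset.univ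
      (fun i => w i.succ) (fun i _ => (hwAi i).1) hw0
    have hall (i : Fin (n + 1)) : w i = 0 :=
      Fin.cases hzero (fun i => hsucc i (Finset.mem_univ i)) i
    intro i hi
    have := hall i
    simpa [w, hi] using this
  · refine eq_top_iff.2 fun x _ => ?_
    have hy : φ (x - ι (φ x)) = 0 := by rw [map_sub, hφι, sub_self]
    rw [← add_sub_cancel (ι (φ x)) x, ← hπsum (x - ι (φ x))]
    refine Submodule.add_mem _ (Submodule.mem_iSup_of_mem 0 (hιmem _))
      (Submodule.sum_mem _ fun i _ => Submodule.mem_iSup_of_mem i.succ ?_)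
    refine ⟨hπmem i _, ?_⟩
    change φ _ = 0
    rw [hφmem i (hπmem i _), hψπ, ← heφ, hy, map_zero]

end Modules

/-- The subring of endomorphisms preserving a submodule. -/
def Submodule.stabilizerSubring {R : Type u} {E : Type v} [Ring R] [AddCommGroup E] [Module R E]
    (M : Submodule R E) : Subring (Module.End R E) where
  carrier := {f | ∀ x ∈ M, f x ∈ M}
  mul_mem' hf hg x hx := hf _ (hg x hx)
  one_mem' _ hx := hx
  add_mem' hf hg x hx := M.add_mem (hf x hx) (hg x hx)
  zero_mem' _ _ := M.zero_mem
  neg_mem' hf x hx := M.neg_mem (hf x hx)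

/-- Every automorphism-invariant module satisfies the finite exchange property. -/
theorem stmt7 {R : Type u} {E : Type v} [Ring R] [AddCommGroup E] [Module R E]
    (hE : Module.Injective R E) (M : Submodule R E)
    (hess : IsEssential M)
    (hinv : ∀ φ : E ≃ₗ[R] E, ∀ x ∈ M, φ x ∈ M) :
    FiniteExchange R ↥M := by
  have hT (f : Module.End R E) (hf : IsUnit f) : f ∈ M.stabilizerSubring := fun x hx =>
    hinv (LinearEquiv.ofBijective f ((Module.End.isUnit_iff f).1 hf)) x hx
  have hunit (s : Module.End R E) (hs : s ∈ essentialKerIdeal R E) : IsUnit (1 + s) :=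
    isUnit_of_one_sub_mem hE (by simpa using hs)
  have hIT (s : Module.End R E) (hs : s ∈ essentialKerIdeal R E) : s ∈ M.stabilizerSubring := by
    simpa using M.stabilizerSubring.sub_mem (hT _ (hunit s hs)) M.stabilizerSubring.one_mem
  refine finiteExchange_of_exchange_end fun a => ?_
  obtain ⟨a', ha'⟩ := hE.out M.subtype M.injective_subtype (M.subtype.comp a)
  have haT : a' ∈ M.stabilizerSubring := fun x hx => by
    have := ha' ⟨x, hx⟩
    rw [Submodule.subtype_apply] at this
    exact this ▸ (a ⟨x, hx⟩).2
  have hres (x : M) : a' x = a x := ha' x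
  obtain ⟨b, hb, hab⟩ := exists_sub_mul_mul_mem_of_units_mem hE hT haT
  obtain ⟨e, r, hr, s, hs, hee, her, hes⟩ := exists_idempotent_of_sub_mul_mul_mem hIT hunit hT
    (fun _ => exists_idempotent_sub_mem hE) haT hb hab
  have he : e ∈ M.stabilizerSubring := her ▸ M.stabilizerSubring.mul_mem hr haT
  refine ⟨e.restrict he, r.restrict hr, s.restrict hs, ?_, ?_, ?_⟩
  · exact LinearMap.ext fun x => Subtype.ext (LinearMap.congr_fun hee (x : E))
  · refine LinearMap.ext fun x => Subtype.ext ?_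
    change e x = r (a x : E)
    rw [← hres, her]
    rfl
  · refine LinearMap.ext fun x => Subtype.ext ?_
    change (x : E) - e x = s ((x : E) - (a x : E))
    rw [← hres]
    exact LinearMap.congr_fun hes (x : E)
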